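/- For every n ≥ 2 there exists a global solution u to the thin obstacle problem (with zero obstacle) in ℝ^{n+1}, with polynomial growth of order 4, whose contact set Λ(u) is compact and has a connected component that is nonconvex. -/

import Mathlib

open MeasureTheory Metric Set Filter

noncomputable section

/-- The point `(x', t)` of `ℝ^{n+1}`, where `x' ∈ ℝ^n`. -/
def thinEmbed (n : ℕ) (x' : EuclideanSpace ℝ (Fin n)) (t : ℝ) :
    EuclideanSpace ℝ (Fin (n + 1)) :=
  (EuclideanSpace.equiv (Fin (n + 1)) ℝ).symm (Fin.snoc (fun i => x' i) t)

/-- Projection of a point of `ℝ^{n+1}` to its first `n` coordinates. -/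
def thinProj (n : ℕ) (x : EuclideanSpace ℝ (Fin (n + 1))) : EuclideanSpace ℝ (Fin n) :=
  (EuclideanSpace.equiv (Fin n) ℝ).symm (fun i => x i.castSucc)

/-- The Laplacian of `f : ℝ^d → ℝ`: the sum of pure second partial derivatives. -/
def lapl (d : ℕ) (f : EuclideanSpace ℝ (Fin d) → ℝ) (x : EuclideanSpace ℝ (Fin d)) : ℝ :=
  ∑ i : Fin d,
    fderiv ℝ (fun y => fderiv ℝ f y (EuclideanSpace.single i 1)) x (EuclideanSpace.single i 1)

/-- `f` is harmonic on a set: twice continuously differentiable with vanishing Laplacian. -/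
def IsHarmonicOnSet (d : ℕ) (f : EuclideanSpace ℝ (Fin d) → ℝ)
    (s : Set (EuclideanSpace ℝ (Fin d))) : Prop :=
  ContDiffOn ℝ 2 f s ∧ ∀ x ∈ s, lapl d f x = 0

/-- Super-mean-value property w.r.t. averages over balls
(encodes `Δf ≤ 0` for continuous `f`). -/
def SuperMeanVal (d : ℕ) (f : EuclideanSpace ℝ (Fin d) → ℝ) : Prop :=
  ∀ (x : EuclideanSpace ℝ (Fin d)) (r : ℝ), 0 < r → (⨍ y in Metric.ball x r, f y) ≤ f x

/-- The contact set `Λ_φ(u) = {(x',0) : u(x',0) = φ(x')}`. -/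
def contactSet (n : ℕ) (φ : EuclideanSpace ℝ (Fin n) → ℝ)
    (u : EuclideanSpace ℝ (Fin (n + 1)) → ℝ) : Set (EuclideanSpace ℝ (Fin (n + 1))) :=
  {x | x (Fin.last n) = 0 ∧ u x = φ (thinProj n x)}

/-- Global solution to the thin obstacle problem in `ℝ^{n+1}` with thin obstacle `φ`:
continuous, even in the last variable, above the obstacle on the thin space,
harmonic outside the contact set, and superharmonic (mean value inequality). -/
def IsGlobalSolution (n : ℕ) (φ : EuclideanSpace ℝ (Fin n) → ℝ)
    (u : EuclideanSpace ℝ (Fin (n + 1)) → ℝ) : Prop :=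
  Continuous u ∧
  (∀ x' t, u (thinEmbed n x' t) = u (thinEmbed n x' (-t))) ∧
  (∀ x', φ x' ≤ u (thinEmbed n x' 0)) ∧
  IsHarmonicOnSet (n + 1) u (contactSet n φ u)ᶜ ∧
  SuperMeanVal (n + 1) u

/-- Evaluation of a real polynomial at a point of `ℝ^d`. -/
def pev {d : ℕ} (q : MvPolynomial (Fin d) ℝ) (x : EuclideanSpace ℝ (Fin d)) : ℝ :=
  MvPolynomial.eval (fun i => x i) q

/-- Polynomial growth (of some order). -/
def HasPolyGrowth (d : ℕ) (u : EuclideanSpace ℝ (Fin d) → ℝ) : Prop :=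
  ∃ (m : ℕ) (C : ℝ), ∀ x, |u x| ≤ C * (1 + ‖x‖ ^ m)

/-- Polynomial growth of order exactly `m` (and `m` is the smallest such order). -/
def PolyGrowthOrder (d : ℕ) (u : EuclideanSpace ℝ (Fin d) → ℝ) (m : ℕ) : Prop :=
  (∃ C : ℝ, ∀ x, |u x| ≤ C * (1 + ‖x‖ ^ m)) ∧
  ∀ m' : ℕ, (∃ C : ℝ, ∀ x, |u x| ≤ C * (1 + ‖x‖ ^ m')) → m ≤ m'

/-- The class `𝒫ᵒ_{n+1}`: polynomials `q` even in the last variable such that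
`x_{n+1} q(x)` is harmonic and `closure {q(·,0) < 0}` is compact. -/
def MemPo (n : ℕ) (q : MvPolynomial (Fin (n + 1)) ℝ) : Prop :=
  (∀ x' t, pev q (thinEmbed n x' t) = pev q (thinEmbed n x' (-t))) ∧
  IsHarmonicOnSet (n + 1) (fun x => x (Fin.last n) * pev q x) Set.univ ∧
  IsCompact (closure {x' : EuclideanSpace ℝ (Fin n) | pev q (thinEmbed n x' 0) < 0})

/-- The class `𝒫ᵉ_{n+1}`: harmonic polynomials `p` even in the last variable such that
`closure {p(·,0) < 0}` is compact. -/
def MemPe (n : ℕ) (p : MvPolynomial (Fin (n + 1)) ℝ) : Prop :=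
  (∀ x' t, pev p (thinEmbed n x' t) = pev p (thinEmbed n x' (-t))) ∧
  IsHarmonicOnSet (n + 1) (pev p) Set.univ ∧
  IsCompact (closure {x' : EuclideanSpace ℝ (Fin n) | pev p (thinEmbed n x' 0) < 0})

/-- `f(x) → 0` as `|x| → ∞`. -/
def VanishAtInfty (d : ℕ) (f : EuclideanSpace ℝ (Fin d) → ℝ) : Prop :=
  ∀ ε > 0, ∃ R : ℝ, ∀ x, R ≤ ‖x‖ → |f x| < ε

/-- The embedding of a subset of `ℝ^n` into the thin space of `ℝ^{n+1}`. -/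
def thinSet (n : ℕ) (S : Set (EuclideanSpace ℝ (Fin n))) :
    Set (EuclideanSpace ℝ (Fin (n + 1))) :=
  (fun x' => thinEmbed n x' 0) '' S

/-- The free boundary `Γ(u)`: the boundary in `ℝ^n` of the positivity set, embedded. -/
def freeBoundary (n : ℕ) (u : EuclideanSpace ℝ (Fin (n + 1)) → ℝ) :
    Set (EuclideanSpace ℝ (Fin (n + 1))) :=
  thinSet n (frontier {x' : EuclideanSpace ℝ (Fin n) | 0 < u (thinEmbed n x' 0)})

/-- Negating the `i`-th coordinate of a point of `ℝ^d`. -/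
def negCoordAt (d : ℕ) (i : Fin d) (x : EuclideanSpace ℝ (Fin d)) :
    EuclideanSpace ℝ (Fin d) :=
  (EuclideanSpace.equiv (Fin d) ℝ).symm (Function.update (fun j => x j) i (-(x i)))

/-- The constant `ρ̄(k, n)`, where `κ = k/(n-1)`. -/
def rhoBar (k n : ℕ) : ℝ :=
  ((k : ℝ) / ((n : ℝ) - 1)) ^ (-(1 : ℝ) / (((n : ℝ) - 1) * ((k : ℝ) / ((n : ℝ) - 1) + 1))) *
    (((k : ℝ) / ((n : ℝ) - 1)) ^
        (-((k : ℝ) / ((n : ℝ) - 1)) / ((k : ℝ) / ((n : ℝ) - 1) + 1)) +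
      ((k : ℝ) / ((n : ℝ) - 1)) ^ ((1 : ℝ) / ((k : ℝ) / ((n : ℝ) - 1) + 1))) ^
      (-(1 : ℝ) / (((n : ℝ) - 1) * ((k : ℝ) / ((n : ℝ) - 1))))

/-- The barrier function `g_{A,t}(r) = A r^{1-n} + t - 1 + r^k`. -/
def gfun (n k : ℕ) (A t r : ℝ) : ℝ :=
  A * r ^ ((1 : ℝ) - (n : ℝ)) + t - 1 + r ^ k

/-- The harmonic polynomial on `ℝ^{n+1}`, even in the last variable, whose restriction to the thin
space is `(|x'|² - 1)²`. -/
def sphereSolution (n : ℕ) (x : EuclideanSpace ℝ (Fin (n + 1))) : ℝ :=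
  (‖x‖ ^ 2) ^ 2 - 2 * (n + 3) * (‖x‖ ^ 2 * x (Fin.last n) ^ 2)
    + (n + 3) * (n + 5) / 3 * x (Fin.last n) ^ 4 - 2 * ‖x‖ ^ 2
    + 2 * (n + 1) * x (Fin.last n) ^ 2 + 1

lemma sphereSolution_contDiff (n : ℕ) : ContDiff ℝ 2 (sphereSolution n) := by
  have h1 : ContDiff ℝ 2 (fun x : EuclideanSpace ℝ (Fin (n + 1)) => ‖x‖ ^ 2) := contDiff_norm_sq ℝ
  unfold sphereSolution
  fun_prop

lemma sphereSolution_of_last_eq_zero {n : ℕ} {x : EuclideanSpace ℝ (Fin (n + 1))}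
    (hx : x (Fin.last n) = 0) : sphereSolution n x = (‖x‖ ^ 2 - 1) ^ 2 := by
  simp only [sphereSolution, hx]
  ring

lemma hasFDerivAt_coord {d : ℕ} (i : Fin d) (x : EuclideanSpace ℝ (Fin d)) :
    HasFDerivAt (fun y : EuclideanSpace ℝ (Fin d) => y i)
      (EuclideanSpace.proj i : EuclideanSpace ℝ (Fin d) →L[ℝ] ℝ) x :=
  (EuclideanSpace.proj i : EuclideanSpace ℝ (Fin d) →L[ℝ] ℝ).hasFDerivAt

lemma fderiv_sphereSolution (n : ℕ) (x : EuclideanSpace ℝ (Fin (n + 1))) (i : Fin (n + 1)) :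
    fderiv ℝ (sphereSolution n) x (EuclideanSpace.single i 1) =
      4 * ‖x‖ ^ 2 * x i
      - 4 * (n + 3) * (x i * x (Fin.last n) ^ 2
          + (if Fin.last n = i then 1 else 0) * (‖x‖ ^ 2 * x (Fin.last n)))
      + 4 / 3 * (n + 3) * (n + 5) * (if Fin.last n = i then 1 else 0) * x (Fin.last n) ^ 3
      - 4 * x i + 4 * (n + 1) * (if Fin.last n = i then 1 else 0) * x (Fin.last n) := by
  have hN := (hasStrictFDerivAt_norm_sq x).hasFDerivAt
  have hT := hasFDerivAt_coord (Fin.last n) x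
  have h := ((((((hN.pow 2).sub ((hN.mul (hT.pow 2)).const_mul (2 * ((n : ℝ) + 3)))).add
    ((hT.pow 4).const_mul (((n : ℝ) + 3) * (n + 5) / 3))).sub (hN.const_mul 2)).add
    ((hT.pow 2).const_mul (2 * ((n : ℝ) + 1)))).add_const 1)
  rw [show fderiv ℝ (sphereSolution n) x = _ from HasFDerivAt.fderiv h]
  by_cases hil : Fin.last n = i
  · subst hil
    simp [EuclideanSpace.inner_single_right]
    ring
  · simp [EuclideanSpace.inner_single_right, hil]
    ring

lemma lapl_sphereSolution (n : ℕ) (x : EuclideanSpace ℝ (Fin (n + 1))) :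
    lapl (n + 1) (sphereSolution n) x = 0 := by
  have key : ∀ i : Fin (n + 1),
      fderiv ℝ (fun y => fderiv ℝ (sphereSolution n) y (EuclideanSpace.single i 1)) x
        (EuclideanSpace.single i 1) =
      4 * ‖x‖ ^ 2 - 4 * (n + 3) * x (Fin.last n) ^ 2 - 4 + 8 * x i ^ 2
      + (if Fin.last n = i then 1 else 0) * (-16 * (n + 3) * x (Fin.last n) ^ 2
        - 4 * (n + 3) * ‖x‖ ^ 2 + 4 * (n + 3) * (n + 5) * x (Fin.last n) ^ 2 + 4 * (n + 1)) := by
    intro i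
    simp only [fderiv_sphereSolution]
    have hN := (hasStrictFDerivAt_norm_sq x).hasFDerivAt
    have hT := hasFDerivAt_coord (Fin.last n) x
    have hi := hasFDerivAt_coord i x
    set c : ℝ := if Fin.last n = i then 1 else 0 with hc
    have h := ((((((hN.const_mul 4).mul hi).sub (((hi.mul (hT.pow 2)).add
      ((hN.mul hT).const_mul c)).const_mul (4 * ((n : ℝ) + 3)))).add
      ((hT.pow 3).const_mul (4 / 3 * ((n : ℝ) + 3) * (n + 5) * c))).sub (hi.const_mul 4)).add
      (hT.const_mul (4 * ((n : ℝ) + 1) * c)))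
    refine (congrArg (fun L => L (EuclideanSpace.single i 1)) h.fderiv).trans ?_
    by_cases hil : Fin.last n = i
    · subst hil
      simp [EuclideanSpace.inner_single_right, hc]
      ring
    · simp [EuclideanSpace.inner_single_right, hc, hil]
      ring
  have hs : ∑ i, x i ^ 2 = ‖x‖ ^ 2 := by simp [EuclideanSpace.norm_sq_eq]
  simp only [lapl, key, Finset.sum_add_distrib, Finset.sum_const, Finset.card_univ,
    Fintype.card_fin, ← Finset.mul_sum, ← Finset.sum_mul, hs, nsmul_eq_mul]
  simp
  ring

section Moments

variable {d : ℕ}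

lemma integrableOn_ball_of_continuous {f : EuclideanSpace ℝ (Fin d) → ℝ} (hf : Continuous f)
    (x : EuclideanSpace ℝ (Fin d)) (r : ℝ) : IntegrableOn f (ball x r) :=
  (hf.continuousOn.integrableOn_compact (isCompact_closedBall x r)).mono_set ball_subset_closedBall

lemma setIntegral_ball_comp_isometry
    (e : EuclideanSpace ℝ (Fin d) ≃ₗᵢ[ℝ] EuclideanSpace ℝ (Fin d))
    (f : EuclideanSpace ℝ (Fin d) → ℝ) (r : ℝ) :
    ∫ h in ball 0 r, f (e h) = ∫ h in ball 0 r, f h := by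
  have := e.measurePreserving.setIntegral_preimage_emb
    e.toHomeomorph.measurableEmbedding f (ball 0 r)
  simpa using this

/-- Rotation invariance of the moments of a ball. -/
lemma exists_setIntegral_inner_pow (d k : ℕ) (r : ℝ) : ∃ K : ℝ,
    ∀ v : EuclideanSpace ℝ (Fin d), ∫ h in ball 0 r, inner ℝ v h ^ (k + 1) = K * ‖v‖ ^ (k + 1) := by
  have hunit : ∀ v w : EuclideanSpace ℝ (Fin d), ‖v‖ = ‖w‖ →
      ∫ h in ball 0 r, inner ℝ v h ^ (k + 1) = ∫ h in ball 0 r, inner ℝ w h ^ (k + 1) := by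
    intro v w hvw
    let e := (ℝ ∙ (v - w))ᗮ.reflection
    have he : e v = w := Submodule.reflection_sub hvw
    rw [← setIntegral_ball_comp_isometry e (fun h => inner ℝ w h ^ (k + 1)), ← he]
    simp only [LinearIsometryEquiv.inner_map_map]
  rcases Nat.eq_zero_or_pos d with rfl | hd
  · refine ⟨0, fun v => ?_⟩
    simp [Subsingleton.elim v 0]
  · let w : EuclideanSpace ℝ (Fin d) := EuclideanSpace.single ⟨0, hd⟩ 1
    have hw : ‖w‖ = 1 := by simp [w]
    refine ⟨∫ h in ball 0 r, inner ℝ w h ^ (k + 1), fun v => ?_⟩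
    rw [hunit v (‖v‖ • w) (by simp [norm_smul, hw])]
    simp only [inner_smul_left, mul_pow, RCLike.conj_to_real, integral_const_mul]
    ring

lemma exists_setIntegral_inner_mul_inner (d : ℕ) (r : ℝ) : ∃ K : ℝ,
    ∀ v w : EuclideanSpace ℝ (Fin d),
      ∫ h in ball 0 r, inner ℝ v h * inner ℝ w h = K * inner ℝ v w := by
  obtain ⟨K, hK⟩ := exists_setIntegral_inner_pow d 1 r
  refine ⟨K, fun v w => ?_⟩
  have e : ∀ h : EuclideanSpace ℝ (Fin d), inner ℝ v h * inner ℝ w h =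
      (1 / 4) * (inner ℝ (v + w) h ^ 2 - inner ℝ (v - w) h ^ 2) := by
    intro h
    rw [inner_add_left, inner_sub_left]
    ring
  simp_rw [e]
  rw [integral_const_mul, integral_sub (integrableOn_ball_of_continuous (by fun_prop) 0 r)
    (integrableOn_ball_of_continuous (by fun_prop) 0 r), hK, hK, norm_add_sq_real, norm_sub_sq_real]
  ring

lemma exists_setIntegral_inner_sq_mul_inner_sq (d : ℕ) (r : ℝ) : ∃ K : ℝ,
    ∀ v w : EuclideanSpace ℝ (Fin d),
      ∫ h in ball 0 r, inner ℝ v h ^ 2 * inner ℝ w h ^ 2 =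
        K * (‖v‖ ^ 2 * ‖w‖ ^ 2 + 2 * inner ℝ v w ^ 2) := by
  obtain ⟨K, hK⟩ := exists_setIntegral_inner_pow d 3 r
  refine ⟨K / 3, fun v w => ?_⟩
  have e : ∀ h : EuclideanSpace ℝ (Fin d), inner ℝ v h ^ 2 * inner ℝ w h ^ 2 =
      (1 / 12) * (inner ℝ (v + w) h ^ 4 + inner ℝ (v - w) h ^ 4
        - (2 * inner ℝ v h ^ 4 + 2 * inner ℝ w h ^ 4)) := by
    intro h
    rw [inner_add_left, inner_sub_left]
    ring
  have hinteg : ∀ {f : EuclideanSpace ℝ (Fin d) → ℝ}, Continuous f → IntegrableOn f (ball 0 r) :=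
    fun hf => integrableOn_ball_of_continuous hf 0 r
  simp_rw [e]
  rw [integral_const_mul, integral_sub (hinteg (by fun_prop)) (hinteg (by fun_prop)),
    integral_add (hinteg (by fun_prop)) (hinteg (by fun_prop)),
    integral_add (hinteg (by fun_prop)) (hinteg (by fun_prop)), integral_const_mul, integral_const_mul,
    hK, hK, hK, hK, show ‖v + w‖ ^ (3 + 1) = (‖v + w‖ ^ 2) ^ 2 by ring,
    show ‖v - w‖ ^ (3 + 1) = (‖v - w‖ ^ 2) ^ 2 by ring, norm_add_sq_real, norm_sub_sq_real]
  ring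

end Moments

/-- The mean value property of `sphereSolution`. -/
lemma setIntegral_ball_sphereSolution (n : ℕ) (x : EuclideanSpace ℝ (Fin (n + 1))) (r : ℝ) :
    ∫ y in ball x r, sphereSolution n y = volume.real (ball x r) * sphereSolution n x := by
  have hcont : Continuous (sphereSolution n) := (sphereSolution_contDiff n).continuous
  have hinteg : ∀ {f : EuclideanSpace ℝ (Fin (n + 1)) → ℝ}, Continuous f →
      IntegrableOn f (ball 0 r) := fun hf => integrableOn_ball_of_continuous hf 0 r
  obtain ⟨k, hk⟩ := exists_setIntegral_inner_mul_inner (n + 1) r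
  obtain ⟨K, hK⟩ := exists_setIntegral_inner_sq_mul_inner_sq (n + 1) r
  have hshift : ∫ y in ball x r, sphereSolution n y =
      ∫ h in ball 0 r, sphereSolution n (x + h) := by
    have := (measurePreserving_add_left volume x).setIntegral_preimage_emb
      (measurableEmbedding_addLeft x) (sphereSolution n) (ball x r)
    rw [← this]
    simp
  have hneg : ∫ h in ball 0 r, sphereSolution n (x - h) =
      ∫ h in ball 0 r, sphereSolution n (x + h) := by
    have := setIntegral_ball_comp_isometry (LinearIsometryEquiv.neg ℝ)
      (fun h => sphereSolution n (x + h)) r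
    simpa [sub_eq_add_neg] using this
  have hvol : volume.real (ball x r) =
      volume.real (ball (0 : EuclideanSpace ℝ (Fin (n + 1))) r) := by
    simp [Measure.real, Measure.addHaar_ball_center]
  set e : EuclideanSpace ℝ (Fin (n + 1)) := EuclideanSpace.single (Fin.last n) 1 with he
  have hei : ∀ h : EuclideanSpace ℝ (Fin (n + 1)), inner ℝ e h = h (Fin.last n) := by
    intro h
    simp [he, EuclideanSpace.inner_single_left]
  have hsq : ∀ h : EuclideanSpace ℝ (Fin (n + 1)),
      ‖h‖ ^ 2 = ∑ i, inner ℝ (EuclideanSpace.single i (1 : ℝ)) h ^ 2 := by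
    intro h
    simp [EuclideanSpace.norm_sq_eq, EuclideanSpace.inner_single_left]
  have hxx : inner ℝ x x = ‖x‖ ^ 2 := real_inner_self_eq_norm_sq x
  have hσ : ∫ h in ball (0 : EuclideanSpace ℝ (Fin (n + 1))) r, ‖h‖ ^ 2 = k * (n + 1) := by
    simp_rw [hsq, pow_two]
    rw [integral_finsetSum _ fun i _ => hinteg (by fun_prop)]
    simp [hk, mul_comm]
  have hσw : ∀ w : EuclideanSpace ℝ (Fin (n + 1)),
      ∫ h in ball (0 : EuclideanSpace ℝ (Fin (n + 1))) r, ‖h‖ ^ 2 * inner ℝ w h ^ 2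
        = K * (n + 3) * ‖w‖ ^ 2 := by
    intro w
    simp_rw [hsq, Finset.sum_mul]
    rw [integral_finsetSum _ fun i _ => hinteg (by fun_prop)]
    simp_rw [hK, ← Finset.mul_sum, Finset.sum_add_distrib, ← Finset.mul_sum, ← hsq w]
    simp
    ring
  have hσσ : ∫ h in ball (0 : EuclideanSpace ℝ (Fin (n + 1))) r, ‖h‖ ^ 2 * ‖h‖ ^ 2
        = K * (n + 3) * (n + 1) := by
    conv_lhs => enter [2, h, 2]; rw [hsq]
    simp_rw [Finset.mul_sum]
    rw [integral_finsetSum _ fun i _ => hinteg (by fun_prop)]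
    simp_rw [hσw]
    simp [mul_comm]
  have hexp : ∀ h, sphereSolution n (x + h) + sphereSolution n (x - h) =
      2 * sphereSolution n x
      + ((4 * ‖x‖ ^ 2 - 4 * (n + 3) * x (Fin.last n) ^ 2 - 4) * ‖h‖ ^ 2
      + (8 * (inner ℝ x h * inner ℝ x h)
      + ((-4 * (n + 3) * ‖x‖ ^ 2 + 4 * (n + 3) * (n + 5) * x (Fin.last n) ^ 2 + 4 * (n + 1))
          * (inner ℝ e h * inner ℝ e h)
      + (-16 * (n + 3) * x (Fin.last n) * (inner ℝ e h * inner ℝ x h)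
      + (2 * (‖h‖ ^ 2 * ‖h‖ ^ 2)
      + (-4 * (n + 3) * (‖h‖ ^ 2 * inner ℝ e h ^ 2)
      + 2 * ((n + 3) * (n + 5) / 3) * (inner ℝ e h ^ 2 * inner ℝ e h ^ 2))))))) := by
    intro h
    simp only [sphereSolution, hei, norm_add_sq_real, norm_sub_sq_real, PiLp.add_apply,
      PiLp.sub_apply]
    ring
  have h2 : ∫ h in ball 0 r, (sphereSolution n (x + h) + sphereSolution n (x - h)) =
      2 * (volume.real (ball x r) * sphereSolution n x) := by
    simp_rw [hexp]
    rw [integral_add (hinteg (by fun_prop)) (hinteg (by fun_prop)),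
      integral_add (hinteg (by fun_prop)) (hinteg (by fun_prop)),
      integral_add (hinteg (by fun_prop)) (hinteg (by fun_prop)),
      integral_add (hinteg (by fun_prop)) (hinteg (by fun_prop)),
      integral_add (hinteg (by fun_prop)) (hinteg (by fun_prop)),
      integral_add (hinteg (by fun_prop)) (hinteg (by fun_prop)),
      integral_add (hinteg (by fun_prop)) (hinteg (by fun_prop))]
    simp_rw [integral_const_mul]
    rw [hσ, hk, hk, hk, hσσ, hσw, hK, hvol]
    have hne : ‖e‖ = 1 := by simp [he]
    simp only [hei, hne, hxx, setIntegral_const, smul_eq_mul]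
    simp [he]
    ring
  rw [integral_add (hinteg (by fun_prop)) (hinteg (by fun_prop)), hneg] at h2
  rw [hshift]
  linarith

lemma contactSet_sphereSolution (n : ℕ) :
    contactSet n (fun _ => 0) (sphereSolution n) = {x | x (Fin.last n) = 0 ∧ ‖x‖ = 1} := by
  ext x
  simp only [contactSet, mem_ofPred_eq]
  refine and_congr_right fun hx => ?_
  rw [sphereSolution_of_last_eq_zero hx, sq_eq_zero_iff, sub_eq_zero,
    pow_eq_one_iff_of_nonneg (norm_nonneg x) two_ne_zero]

@[simp] lemma thinEmbed_last (n : ℕ) (x' : EuclideanSpace ℝ (Fin n)) (t : ℝ) :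
    thinEmbed n x' t (Fin.last n) = t := by
  simp [thinEmbed]

lemma norm_sq_thinEmbed (n : ℕ) (x' : EuclideanSpace ℝ (Fin n)) (t : ℝ) :
    ‖thinEmbed n x' t‖ ^ 2 = ‖x'‖ ^ 2 + t ^ 2 := by
  simp [thinEmbed, EuclideanSpace.norm_sq_eq, Fin.sum_univ_castSucc]

lemma norm_thinEmbed_zero (n : ℕ) (x' : EuclideanSpace ℝ (Fin n)) :
    ‖thinEmbed n x' 0‖ = ‖x'‖ := by
  have := norm_sq_thinEmbed n x' 0
  rw [zero_pow two_ne_zero, add_zero] at this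
  exact (sq_eq_sq₀ (norm_nonneg _) (norm_nonneg _)).1 this

lemma continuous_thinEmbed_zero (n : ℕ) : Continuous fun x' => thinEmbed n x' 0 := by
  refine (EuclideanSpace.equiv (Fin (n + 1)) ℝ).symm.continuous.comp (continuous_pi fun i => ?_)
  refine Fin.lastCases ?_ (fun j => ?_) i
  · simpa using continuous_const
  · simp only [Fin.snoc_castSucc]
    fun_prop

lemma thinEmbed_zero_thinProj {n : ℕ} {x : EuclideanSpace ℝ (Fin (n + 1))}
    (hx : x (Fin.last n) = 0) : thinEmbed n (thinProj n x) 0 = x := by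
  ext i
  refine Fin.lastCases ?_ (fun j => ?_) i
  · simp [hx]
  · simp [thinEmbed, thinProj]

lemma isPreconnected_thin_sphere {n : ℕ} (hn : 2 ≤ n) :
    IsPreconnected {x : EuclideanSpace ℝ (Fin (n + 1)) | x (Fin.last n) = 0 ∧ ‖x‖ = 1} := by
  have hrank : 1 < Module.rank ℝ (EuclideanSpace ℝ (Fin n)) := by
    rw [← Module.finrank_eq_rank, finrank_euclideanSpace_fin]
    exact_mod_cast hn
  convert (isPreconnected_sphere hrank 0 1).image _ (continuous_thinEmbed_zero n).continuousOn
  ext x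
  simp only [mem_ofPred_eq, mem_image, mem_sphere_zero_iff_norm]
  constructor
  · rintro ⟨h0, h1⟩
    refine ⟨thinProj n x, ?_, thinEmbed_zero_thinProj h0⟩
    rw [← norm_thinEmbed_zero, thinEmbed_zero_thinProj h0, h1]
  · rintro ⟨y, hy, rfl⟩
    exact ⟨thinEmbed_last n y 0, by rw [norm_thinEmbed_zero, hy]⟩

lemma not_convex_thin_sphere {n : ℕ} (hn : 1 ≤ n) :
    ¬Convex ℝ {x : EuclideanSpace ℝ (Fin (n + 1)) | x (Fin.last n) = 0 ∧ ‖x‖ = 1} := by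
  intro hconv
  let a := thinEmbed n (EuclideanSpace.single ⟨0, hn⟩ 1) 0
  have ha0 : a (Fin.last n) = 0 := thinEmbed_last n _ 0
  have ha1 : ‖a‖ = 1 := by simp [a, norm_thinEmbed_zero]
  have h := hconv.midpoint_mem (x := a) (y := -a) ⟨ha0, ha1⟩ ⟨by simp [ha0], by simp [ha1]⟩
  simp at h

lemma abs_sphereSolution_le (n : ℕ) (x : EuclideanSpace ℝ (Fin (n + 1))) :
    |sphereSolution n x| ≤ (20 * (n + 3) ^ 2) * (1 + ‖x‖ ^ 4) := by
  have hT : x (Fin.last n) ^ 2 ≤ ‖x‖ ^ 2 := by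
    have := PiLp.norm_apply_le x (Fin.last n)
    rw [← sq_abs]
    exact pow_le_pow_left₀ (abs_nonneg _) this 2
  rw [show ‖x‖ ^ 4 = (‖x‖ ^ 2) ^ 2 by ring]
  have e : sphereSolution n x = (‖x‖ ^ 2) ^ 2 - 2 * (n + 3) * (‖x‖ ^ 2 * x (Fin.last n) ^ 2)
      + (n + 3) * (n + 5) / 3 * (x (Fin.last n) ^ 2) ^ 2 - 2 * ‖x‖ ^ 2
      + 2 * (n + 1) * x (Fin.last n) ^ 2 + 1 := by
    rw [sphereSolution]
    ring
  rw [e]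
  have h0 : 0 ≤ x (Fin.last n) ^ 2 := sq_nonneg _
  have hn : (0 : ℝ) ≤ n := Nat.cast_nonneg n
  generalize x (Fin.last n) ^ 2 = s at *
  generalize ‖x‖ ^ 2 = ρ at *
  generalize (n : ℝ) = N at *
  have hρ : 0 ≤ ρ := h0.trans hT
  have h1 : ρ * s ≤ ρ ^ 2 := by nlinarith
  have h2 : s ^ 2 ≤ ρ ^ 2 := by nlinarith
  have h3 : 2 * ρ ≤ 1 + ρ ^ 2 := by nlinarith [sq_nonneg (ρ - 1)]
  have h4 : 0 ≤ ρ * s := by positivity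
  have b1 := mul_le_mul_of_nonneg_left h1 (by positivity : 0 ≤ 2 * (N + 3))
  have b2 := mul_le_mul_of_nonneg_left h2 (by positivity : 0 ≤ (N + 3) * (N + 5) / 3)
  have b3 := mul_le_mul_of_nonneg_left (by linarith : 2 * s ≤ 1 + ρ ^ 2)
    (by positivity : 0 ≤ N + 1)
  have p1 : 0 ≤ 2 * (N + 3) * (ρ * s) := by positivity
  have p2 : 0 ≤ (N + 3) * (N + 5) / 3 * s ^ 2 := by positivity
  have p3 : 0 ≤ 2 * (N + 1) * s := by positivity
  have q1 : 0 ≤ N * ρ ^ 2 := by positivity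
  have q2 : 0 ≤ N ^ 2 * ρ ^ 2 := by positivity
  have q3 : 0 ≤ ρ ^ 2 := by positivity
  have q4 : 0 ≤ N ^ 2 := by positivity
  rw [abs_le]
  constructor <;> nlinarith

lemma polyGrowthOrder_sphereSolution {n : ℕ} (hn : 1 ≤ n) :
    PolyGrowthOrder (n + 1) (sphereSolution n) 4 := by
  refine ⟨⟨_, abs_sphereSolution_le n⟩, fun m ⟨C, hC⟩ => ?_⟩
  by_contra! hm
  have key : ∀ t : ℝ, 1 ≤ t → (t ^ 2 - 1) ^ 2 ≤ 2 * |C| * t ^ 3 := by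
    intro t ht
    have h := hC (thinEmbed n (EuclideanSpace.single ⟨0, hn⟩ t) 0)
    rw [sphereSolution_of_last_eq_zero (thinEmbed_last n _ 0), norm_thinEmbed_zero] at h
    simp only [PiLp.norm_single, Real.norm_eq_abs, abs_of_pos (by linarith : 0 < t)] at h
    rw [abs_of_nonneg (by positivity)] at h
    have h1 : t ^ m ≤ t ^ 3 := pow_le_pow_right₀ ht (by omega)
    have h2 : 1 ≤ t ^ 3 := one_le_pow₀ ht
    have h3 : 0 ≤ t ^ m := by positivity
    calc (t ^ 2 - 1) ^ 2 ≤ C * (1 + t ^ m) := h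
      _ ≤ |C| * (1 + t ^ m) := mul_le_mul_of_nonneg_right (le_abs_self C) (by linarith)
      _ ≤ |C| * (2 * t ^ 3) := mul_le_mul_of_nonneg_left (by linarith) (abs_nonneg C)
      _ = 2 * |C| * t ^ 3 := by ring
  have h := key (2 * |C| + 3) (by linarith [abs_nonneg C])
  have hc := abs_nonneg C
  generalize |C| = c at *
  have h4 : (2 * c + 3) ^ 3 * 3 ≤ 2 * (2 * c + 3) ^ 2 - 1 := by linarith
  have h5 : (2 * c + 3) ^ 2 * 3 ≤ (2 * c + 3) ^ 3 := by nlinarith [sq_nonneg (2 * c + 3)]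
  nlinarith [sq_nonneg (2 * c + 3)]

lemma isGlobalSolution_sphereSolution (n : ℕ) :
    IsGlobalSolution n (fun _ => 0) (sphereSolution n) := by
  refine ⟨(sphereSolution_contDiff n).continuous, fun x' t => ?_, fun x' => ?_,
    ⟨(sphereSolution_contDiff n).contDiffOn, fun x _ => lapl_sphereSolution n x⟩, fun x r hr => ?_⟩
  · simp only [sphereSolution, norm_sq_thinEmbed, thinEmbed_last]
    ring
  · rw [sphereSolution_of_last_eq_zero (thinEmbed_last n x' 0)]
    positivity
  · have hpos : 0 < volume.real (ball x r) :=
      ENNReal.toReal_pos (measure_ball_pos _ _ hr).ne' measure_ball_lt_top.ne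
    rw [setAverage_eq, setIntegral_ball_sphereSolution, smul_eq_mul,
      inv_mul_cancel_left₀ hpos.ne']

/-- a global solution of growth order 4 with compact contact set having
a nonconvex connected component. -/
theorem statement7 (n : ℕ) (hn : 2 ≤ n) :
    ∃ u : EuclideanSpace ℝ (Fin (n + 1)) → ℝ,
      IsGlobalSolution n (fun _ => 0) u ∧
      PolyGrowthOrder (n + 1) u 4 ∧
      IsCompact (contactSet n (fun _ => 0) u) ∧
      ∃ x ∈ contactSet n (fun _ => 0) u,
        ¬Convex ℝ (connectedComponentIn (contactSet n (fun _ => 0) u) x) := by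
  refine ⟨sphereSolution n, isGlobalSolution_sphereSolution n,
    polyGrowthOrder_sphereSolution (by omega), ?_⟩
  rw [contactSet_sphereSolution]
  refine ⟨?_, thinEmbed n (EuclideanSpace.single ⟨0, by omega⟩ 1) 0, ?_⟩
  · refine (isCompact_sphere 0 1).of_isClosed_subset
      (IsClosed.inter (isClosed_eq (by fun_prop) continuous_const)
        (isClosed_eq continuous_norm continuous_const)) fun x hx => ?_
    simpa using hx.2
  · have hmem : thinEmbed n (EuclideanSpace.single ⟨0, by omega⟩ 1) 0 ∈
        {x : EuclideanSpace ℝ (Fin (n + 1)) | x (Fin.last n) = 0 ∧ ‖x‖ = 1} :=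
      ⟨thinEmbed_last n _ 0, by simp [norm_thinEmbed_zero]⟩
    refine ⟨hmem, ?_⟩
    rw [(isPreconnected_thin_sphere hn).connectedComponentIn hmem]
    exact not_convex_thin_sphere (by omega)

end
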